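/- arXiv:1612.06688 — 2 statements merged into one kernel-verified Lean document; each statement's English description precedes it below -/
import Mathlib

section
/- Define H_γ on the set of pairs (s,t) of real numbers with s ≠ 0, t ≠ 0 and s + t ≠ 0 by H_γ(s,t) = (1 − cosh((s+t)/2)) · [ t(s+t)cosh(s) − s(s+t)cosh(t) + (s−t)(s + t + sinh(s) + sinh(t) − sinh(s+t)) ] / [ s·t·(s+t)·sinh(s/2)·sinh(t/2)·sinh((s+t)/2)² ]. Then H_γ(s,t) tends to 0 as (s,t) tends to (0,0) within the set {(s,t) : s·t·(s+t) ≠ 0}. -/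
open Filter

/-- The entire extension of `sinh x / x`. -/
noncomputable def sinhc : ℝ → ℝ := dslope Real.sinh 0

theorem sinhc_zero : sinhc 0 = 1 := by
  simp [sinhc, Real.deriv_sinh]

theorem mul_sinhc (x : ℝ) : x * sinhc x = Real.sinh x := by
  have h := sub_smul_dslope Real.sinh 0 x
  simpa [sinhc] using h

theorem sinhc_neg (x : ℝ) : sinhc (-x) = sinhc x := by
  rcases eq_or_ne x 0 with rfl | hx
  · simp
  · have h₁ := mul_sinhc x
    have h₂ := mul_sinhc (-x)
    rw [Real.sinh_neg] at h₂
    exact mul_left_cancel₀ hx (by linarith)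

theorem sinhc_pos (x : ℝ) : 0 < sinhc x := by
  rcases lt_trichotomy x 0 with hx | rfl | hx
  · have h := mul_sinhc x
    have h₁ := Real.sinh_neg_iff.2 hx
    nlinarith
  · simp [sinhc_zero]
  · have h := mul_sinhc x
    have h₁ := Real.sinh_pos_iff.2 hx
    nlinarith

theorem hasStrictDerivAt_sinhc_zero : HasStrictDerivAt sinhc 0 0 := by
  have h : AnalyticAt ℝ sinhc 0 := by
    obtain ⟨p, hp⟩ : AnalyticAt ℝ Real.sinh 0 := Real.analyticAt_sinh
    exact ⟨_, hp.has_fpower_series_dslope_fslope⟩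
  have h₁ : deriv sinhc 0 = 0 := by
    have h₂ := deriv_comp_neg sinhc 0
    simp only [sinhc_neg, neg_zero] at h₂
    linarith
  simpa only [h₁] using h.hasStrictDerivAt

theorem tendsto_sinhc_div {α : Type*} {l : Filter α} {x y : α → ℝ}
    (hx : Tendsto x l (nhds 0)) (hy : Tendsto y l (nhds 0)) :
    Tendsto (fun p => (sinhc (x p) - sinhc (x p + y p) * sinhc (y p)) / y p) l (nhds 0) := by
  have hs := hasStrictDerivAt_sinhc_zero.isLittleO
  have hxy : Tendsto (fun p => x p + y p) l (nhds 0) := by simpa using hx.add hy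
  have h₁ := (hs.comp_tendsto (hx.prodMk_nhds hxy)).tendsto_div_nhds_zero
  have h₂ := (hs.comp_tendsto (hy.prodMk_nhds
    (tendsto_const_nhds (x := (0 : ℝ))))).tendsto_div_nhds_zero
  have h₃ := hasStrictDerivAt_sinhc_zero.hasDerivAt.continuousAt.tendsto.comp hxy
  have h := h₁.neg.sub (h₃.mul h₂)
  simp only [neg_zero, mul_zero, sub_zero] at h
  refine h.congr fun p => ?_
  rcases eq_or_ne (y p) 0 with hp | hp
  · simp [hp]
  · simp [sinhc_zero]
    field_simp
    ring

/-- The double-angle form of the spectral function, with the removable factors cancelled. -/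
theorem spectral_function_eq {a b : ℝ} (ha : a ≠ 0) (hb : b ≠ 0) (hab : a + b ≠ 0) :
    (1 - Real.cosh (a + b)) *
      ((2 * b * (2 * a + 2 * b) * Real.cosh (2 * a) - 2 * a * (2 * a + 2 * b) * Real.cosh (2 * b)
        + (2 * a - 2 * b) * (2 * a + 2 * b + Real.sinh (2 * a) + Real.sinh (2 * b)
          - Real.sinh (2 * a + 2 * b))) /
        (2 * a * (2 * b) * (2 * a + 2 * b) * Real.sinh a * Real.sinh b * Real.sinh (a + b) ^ 2)) =
    -((sinhc a - sinhc (a + b) * sinhc b) / b / sinhc b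
      - (sinhc b - sinhc (b + a) * sinhc a) / a / sinhc a) / (1 + Real.cosh (a + b)) := by
  have hN : 2 * b * (2 * a + 2 * b) * Real.cosh (2 * a)
      - 2 * a * (2 * a + 2 * b) * Real.cosh (2 * b)
      + (2 * a - 2 * b) * (2 * a + 2 * b + Real.sinh (2 * a) + Real.sinh (2 * b)
        - Real.sinh (2 * a + 2 * b)) =
      8 * (b * (a + b) * Real.sinh a ^ 2 - a * (a + b) * Real.sinh b ^ 2
        - (a - b) * Real.sinh a * Real.sinh b * Real.sinh (a + b)) := by
    have h₁ := Real.cosh_sq a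
    have h₂ := Real.cosh_sq b
    simp only [Real.sinh_add, Real.cosh_two_mul, Real.sinh_two_mul]
    linear_combination (4 * b * (a + b) - 4 * (a - b) * Real.sinh b * Real.cosh b) * h₁
      + (-4 * a * (a + b) - 4 * (a - b) * Real.sinh a * Real.cosh a) * h₂
  have hc : 1 + Real.cosh (a + b) ≠ 0 := by
    have := Real.cosh_pos (a + b)
    positivity
  have hsq : Real.sinh (a + b) ^ 2 = (Real.cosh (a + b) - 1) * (1 + Real.cosh (a + b)) := by
    rw [Real.sinh_sq]; ring
  have hs : Real.sinh (a + b) ≠ 0 := by simpa using hab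
  have hc' : Real.cosh (a + b) - 1 ≠ 0 := by
    intro h
    rw [h, zero_mul] at hsq
    exact hs (by simpa using hsq)
  rw [hN, hsq, ← mul_sinhc a, ← mul_sinhc b, ← mul_sinhc (a + b), add_comm b a]
  have := (sinhc_pos a).ne'
  have := (sinhc_pos b).ne'
  field_simp
  ring

theorem H_gamma_limit :
    Tendsto (fun p : ℝ × ℝ =>
        (1 - Real.cosh ((p.1 + p.2) / 2)) *
          ((p.2 * (p.1 + p.2) * Real.cosh p.1 - p.1 * (p.1 + p.2) * Real.cosh p.2
              + (p.1 - p.2) * (p.1 + p.2 + Real.sinh p.1 + Real.sinh p.2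
                  - Real.sinh (p.1 + p.2))) /
            (p.1 * p.2 * (p.1 + p.2) * Real.sinh (p.1 / 2) * Real.sinh (p.2 / 2)
              * Real.sinh ((p.1 + p.2) / 2) ^ 2)))
      (nhdsWithin (0, 0) {p : ℝ × ℝ | p.1 * p.2 * (p.1 + p.2) ≠ 0})
      (nhds 0) := by
  set l := nhdsWithin ((0, 0) : ℝ × ℝ) {p : ℝ × ℝ | p.1 * p.2 * (p.1 + p.2) ≠ 0} with hl
  have ha : Tendsto (fun p : ℝ × ℝ => p.1 / 2) l (nhds 0) := by
    have h : Continuous fun p : ℝ × ℝ => p.1 / 2 := by fun_prop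
    simpa using (h.tendsto (0, 0)).mono_left nhdsWithin_le_nhds
  have hb : Tendsto (fun p : ℝ × ℝ => p.2 / 2) l (nhds 0) := by
    have h : Continuous fun p : ℝ × ℝ => p.2 / 2 := by fun_prop
    simpa using (h.tendsto (0, 0)).mono_left nhdsWithin_le_nhds
  have hf := hasStrictDerivAt_sinhc_zero.hasDerivAt.continuousAt.tendsto
  rw [sinhc_zero] at hf
  have hcosh : Tendsto (fun p : ℝ × ℝ => 1 + Real.cosh (p.1 / 2 + p.2 / 2)) l (nhds 2) := by
    have h := (Real.continuous_cosh.tendsto (0 + 0)).comp (ha.add hb)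
    have h' := h.const_add 1
    norm_num at h'
    exact h'
  have h := ((((tendsto_sinhc_div ha hb).div (hf.comp hb) one_ne_zero).sub
    ((tendsto_sinhc_div hb ha).div (hf.comp ha) one_ne_zero)).neg).div hcosh two_ne_zero
  norm_num at h
  refine h.congr' ?_
  filter_upwards [self_mem_nhdsWithin] with p hp
  obtain ⟨⟨h₁, h₂⟩, h₃⟩ : (p.1 ≠ 0 ∧ p.2 ≠ 0) ∧ p.1 + p.2 ≠ 0 := by
    simpa only [Set.mem_ofPred_eq, mul_ne_zero_iff] using hp
  have h := spectral_function_eq (a := p.1 / 2) (b := p.2 / 2) (by positivity) (by positivity)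
    (by rw [← add_div]; positivity)
  simp only [mul_div_cancel₀ _ (two_ne_zero' ℝ), ← add_div] at h
  rw [h]
  simp [← add_div]
end

section
/- Let A be an associative unital algebra over ℂ equipped with a star operation (conjugate-linear, antimultiplicative involution). Let φ : A → ℂ be a ℂ-linear functional with the trace property φ(xy) = φ(yx) for all x, y ∈ A, and let δ : A → A be a ℂ-linear derivation (δ(xy) = δ(x)y + xδ(y)) satisfying φ(δ(x)) = 0 and δ(x*) = −(δ(x))* for all x ∈ A. Let u, v ∈ A be selfadjoint elements (u* = u, v* = v) with v invertible. Then for all a, b ∈ A: φ( b* · δ(a) · u ) = φ( (δ(b·u)·v⁻¹)* · a · v ). -/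
/-- Integration by parts: a derivation `δ` with `δ (star x) = -star (δ x)` whose range is killed by
`φ` is formally selfadjoint for the sesquilinear form `(a, w) ↦ φ (star w * a)`. -/
theorem map_star_mul_derivation
    {A : Type*} [Ring A] [Algebra ℂ A] [StarRing A]
    (φ : A →ₗ[ℂ] ℂ)
    (δ : A →ₗ[ℂ] A) (hδ : ∀ x y : A, δ (x * y) = δ x * y + x * δ y)
    (hφδ : ∀ x : A, φ (δ x) = 0)
    (hδstar : ∀ x : A, δ (star x) = -star (δ x))
    (w a : A) :
    φ (star w * δ a) = φ (star (δ w) * a) := by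
  have h := hφδ (star w * a)
  rw [hδ, hδstar, map_add, neg_mul, map_neg] at h
  linear_combination h

theorem adjoint_of_derivation
    {A : Type*} [Ring A] [Algebra ℂ A] [StarRing A] [StarModule ℂ A]
    (φ : A →ₗ[ℂ] ℂ) (hφtr : ∀ x y : A, φ (x * y) = φ (y * x))
    (δ : A →ₗ[ℂ] A) (hδ : ∀ x y : A, δ (x * y) = δ x * y + x * δ y)
    (hφδ : ∀ x : A, φ (δ x) = 0)
    (hδstar : ∀ x : A, δ (star x) = -star (δ x))
    (u v : A) (hu : star u = u) (hv : star v = v) (hvinv : IsUnit v)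
    (a b : A) :
    φ (star b * δ a * u) = φ (star (δ (b * u) * Ring.inverse v) * a * v) := by
  have hv' : v * star (Ring.inverse v) = 1 := by
    rw [← Ring.inverse_star, hv, Ring.mul_inverse_cancel v hvinv]
  calc φ (star b * δ a * u)
      = φ (star (b * u) * δ a) := by rw [hφtr, star_mul, hu, mul_assoc]
    _ = φ (star (δ (b * u)) * a) := map_star_mul_derivation φ δ hδ hφδ hδstar (b * u) a
    _ = φ (v * star (Ring.inverse v) * (star (δ (b * u)) * a)) := by rw [hv', one_mul]
    _ = φ (star (δ (b * u) * Ring.inverse v) * a * v) := by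
      rw [hφtr _ v, star_mul]
      simp only [mul_assoc]
end
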